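/- Let m trucks travel on a common edge, each incurring the same base energy cost c ≥ 0 on that edge, and let them be partitioned into platoons, i.e., nonempty blocks each of size at most L (L ≥ 1 a natural number). With platoon saving factor β ∈ [0,1], the total energy cost Σ over blocks B of [c + (|B| − 1)(1 − β)c] is at least m·c·(1 − β(L−1)/L). Equivalently, the relative energy saving due to platooning is at most β(L−1)/L of the no-platooning cost m·c (for β = 0.1 and L = 4 this bound is 7.5%). -/

import Mathlib

open Finset in
/-- If `m` trucks on a common edge, each with base energy cost `c ≥ 0`, are
partitioned into platoons (nonempty blocks of size at most `L`) and each
follower saves a fraction `β ∈ [0,1]`, then the total energy cost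
`∑_B (c + (|B| - 1)(1-β)c)` is at least `m * c * (1 - β * (L-1)/L)`; i.e. the
relative platooning saving is at most `β * (L-1)/L`. -/
theorem stmt_5 {α : Type*} [DecidableEq α] (T : Finset α) (P : Finset (Finset α))
    (m : ℕ) (hm : T.card = m) (L : ℕ) (hL : 1 ≤ L)
    (c β : ℝ) (hc : 0 ≤ c) (hβ0 : 0 ≤ β) (hβ1 : β ≤ 1)
    (hcover : ∀ a ∈ T, ∃ B ∈ P, a ∈ B)
    (hsub : ∀ B ∈ P, B ⊆ T)
    (hne : ∀ B ∈ P, B.Nonempty)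
    (hdisj : ∀ B1 ∈ P, ∀ B2 ∈ P, B1 ≠ B2 → Disjoint B1 B2)
    (hsize : ∀ B ∈ P, B.card ≤ L) :
    (m : ℝ) * c * (1 - β * ((L : ℝ) - 1) / (L : ℝ)) ≤
      ∑ B ∈ P, (c + ((B.card : ℝ) - 1) * (1 - β) * c) := by
  have hT : T = P.biUnion (fun x => x) := by
    ext a
    simp only [Finset.mem_biUnion]
    constructor
    · exact hcover a
    · rintro ⟨B, hB, ha⟩
      exact hsub B hB ha
  have hcard : (m : ℝ) = ∑ B ∈ P, (B.card : ℝ) := by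
    rw [← hm, hT, Finset.card_biUnion (fun x hx y hy h => hdisj x hx y hy h)]
    push_cast
    rfl
  have hL0 : (0 : ℝ) < L := by exact_mod_cast hL
  rw [hcard, Finset.sum_mul, Finset.sum_mul]
  apply Finset.sum_le_sum
  intro B hB
  have hk : (B.card : ℝ) / L ≤ 1 := by
    rw [div_le_one hL0]
    exact_mod_cast hsize B hB
  have h1 : (B.card : ℝ) * c * (1 - β * ((L : ℝ) - 1) / (L : ℝ))
      = B.card * c - B.card * β * c + (β * c) * (B.card / L) := by
    field_simp
    ring
  rw [h1]
  have h2 := mul_le_mul_of_nonneg_left hk (mul_nonneg hβ0 hc)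
  linarith
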